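/- arXiv:2202.13286 — 6 statements merged into one kernel-verified Lean document; each statement's English description precedes it below -/
import Mathlib

section
/- Let d ≥ 1 and fix i ∈ {1,…,d}. Let c : X → (0,∞) be a local function that does not depend on the coordinates η_0 and η_{e_i} (equivalently c(η^{0,e_i}) = c(η) for all η), and suppose there is a local function h : X → ℝ such that c(η)(η_0 − η_{e_i}) = h(η) − h(τ_{e_i}η) for all η ∈ X. Define P(ρ) := E^{ν_ρ}[h] for ρ ∈ [0,1]. Then for every ρ ∈ (0,1), P'(ρ) = (1/(2ρ(1−ρ))) · E^{ν_ρ}[c(η)(η_0 − η_{e_i})²]. (Green–Kubo formula.) -/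
namespace GK

open Finset

noncomputable section

/-- Occupation value of a site as a real number. -/
def bval (b : Bool) : ℝ := if b then 1 else 0

/-- Bernoulli weight with mean `ρ`. -/
def bern (ρ : ℝ) (b : Bool) : ℝ := if b then ρ else 1 - ρ

/-- Compressibility. -/
def chi (ρ : ℝ) : ℝ := ρ * (1 - ρ)

/-- The `i`-th unit vector of `ℤ^d`. -/
def zvec (d : ℕ) (i : Fin d) : Fin d → ℤ := Pi.single i 1

/-- A function on `{0,1}^{ℤ^d}` depends only on the coordinates in `S`. -/
def IsLocal {d : ℕ} (S : Finset (Fin d → ℤ)) (h : ((Fin d → ℤ) → Bool) → ℝ) : Prop :=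
  ∀ η η' : (Fin d → ℤ) → Bool, (∀ x ∈ S, η x = η' x) → h η = h η'

/-- Expectation under the Bernoulli product measure with mean `ρ`
of a function depending only on the coordinates in `S`. -/
def bExp {d : ℕ} (ρ : ℝ) (S : Finset (Fin d → ℤ)) (h : ((Fin d → ℤ) → Bool) → ℝ) : ℝ :=
  ∑ ζ : {x // x ∈ S} → Bool,
    (∏ x : {x // x ∈ S}, bern ρ (ζ x)) *
      h fun z => if hz : z ∈ S then ζ ⟨z, hz⟩ else false

/-- Exchange of the values at `x` and `y` (lattice version). -/
def exchL {d : ℕ} (η : (Fin d → ℤ) → Bool) (x y : Fin d → ℤ) : (Fin d → ℤ) → Bool :=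
  Function.update (Function.update η x (η y)) y (η x)

/-- Translation by `x`. -/
def transl {d : ℕ} (x : Fin d → ℤ) (η : (Fin d → ℤ) → Bool) : (Fin d → ℤ) → Bool :=
  fun z => η (z + x)

/-- Discrete torus. -/
abbrev Tor (d N : ℕ) := Fin d → ZMod N

/-- Configuration space on the torus. -/
abbrev Conf (d N : ℕ) := Tor d N → Bool

/-- Unit vector on torus. -/
def uvec (d N : ℕ) (i : Fin d) : Tor d N := Pi.single i 1

/-- Exchange of values at `x,y`. -/
def exchT {d N : ℕ} (η : Conf d N) (x y : Tor d N) : Conf d N :=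
  Function.update (Function.update η x (η y)) y (η x)

/-- Flip value at `x`. -/
def flipT {d N : ℕ} (η : Conf d N) (x : Tor d N) : Conf d N :=
  Function.update η x (!(η x))

/-- Cast a lattice vector to the torus. -/
def castT (d N : ℕ) (z : Fin d → ℤ) : Tor d N := fun j => (z j : ZMod N)

/-- Configuration observed around torus point `x`, as a lattice configuration. -/
def obs {d N : ℕ} (η : Conf d N) (x : Tor d N) : (Fin d → ℤ) → Bool :=
  fun z => η (x + castT d N z)

/-- Sum over ordered nearest-neighbour pairs `(x,y)`, `|x-y|=1`. -/
def nnSum (d N : ℕ) [NeZero N] (F : Tor d N → Tor d N → ℝ) : ℝ :=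
  ∑ x : Tor d N, ∑ i : Fin d, (F x (x + uvec d N i) + F x (x - uvec d N i))

/-- Kawasaki generator with exchange rates `cc`. -/
def LK (d N : ℕ) [NeZero N] (cc : Tor d N → Tor d N → Conf d N → ℝ)
    (f : Conf d N → ℝ) (η : Conf d N) : ℝ :=
  (1/2) * ∑ x : Tor d N, ∑ i : Fin d,
    (cc x (x + uvec d N i) η * (f (exchT η x (x + uvec d N i)) - f η)
      + cc x (x - uvec d N i) η * (f (exchT η x (x - uvec d N i)) - f η))

/-- Glauber generator with flip rates `cG`. -/
def LG (d N : ℕ) [NeZero N] (cG : Tor d N → Conf d N → ℝ)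
    (f : Conf d N → ℝ) (η : Conf d N) : ℝ :=
  ∑ x : Tor d N, cG x η * (f (flipT η x) - f η)

/-- Product (Bernoulli) measure with means `u`. -/
def prodM (d N : ℕ) [NeZero N] (u : Tor d N → ℝ) (η : Conf d N) : ℝ :=
  ∏ x : Tor d N, bern (u x) (η x)

/-- Relative entropy. -/
def relEnt {d N : ℕ} [NeZero N] (μ ν : Conf d N → ℝ) : ℝ :=
  ∑ η : Conf d N, μ η * Real.log (μ η / ν η)

/-- Box `[-ℓ,ℓ]^d` in `ℤ^d`. -/
def box (d ℓ : ℕ) : Finset (Fin d → ℤ) :=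
  Fintype.piFinset fun _ => Finset.Icc (-(ℓ:ℤ)) (ℓ:ℤ)

/-- `ℓ`-ball (sup-norm box) around `z` in the torus. -/
def ball (d N : ℕ) (ℓ : ℕ) (z : Tor d N) : Finset (Tor d N) :=
  (box d ℓ).image fun w => z + castT d N w

/-- Block average of a configuration around `x`. -/
def avg (d N : ℕ) (ℓ : ℕ) (x : Tor d N) (η : Conf d N) : ℝ :=
  (1 / (2*(ℓ:ℝ)+1)^d) * ∑ w ∈ box d ℓ, bval (η (x + castT d N w))

open scoped Classical in
/-- Conditional expectation of `F` given the block average `avg` around `x`, under the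
Bernoulli(1/2) product measure. -/
def condExpUnif (d N : ℕ) [NeZero N] (ℓ : ℕ) (x : Tor d N)
    (F : Conf d N → ℝ) (η : Conf d N) : ℝ :=
  (∑ η' : Conf d N, if avg d N ℓ x η' = avg d N ℓ x η
      then F η' * prodM d N (fun _ => (1:ℝ)/2) η' else 0)
    / ∑ η' : Conf d N, if avg d N ℓ x η' = avg d N ℓ x η
        then prodM d N (fun _ => (1:ℝ)/2) η' else 0

/-- The full generator `N² L_K + K L_G` built from translation-invariant lattice rates
`cK i = c_{0,e_i}` and flip rate `cG = c_0`. -/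
def LNgen (d N : ℕ) [NeZero N] (Ksc : ℝ)
    (cK : Fin d → ((Fin d → ℤ) → Bool) → ℝ)
    (cG : ((Fin d → ℤ) → Bool) → ℝ)
    (f : Conf d N → ℝ) (η : Conf d N) : ℝ :=
  (N:ℝ)^2 * ((1/2) * ∑ x : Tor d N, ∑ i : Fin d,
      (cK i (obs η x) * (f (exchT η x (x + uvec d N i)) - f η)
        + cK i (obs η (x - uvec d N i)) * (f (exchT η x (x - uvec d N i)) - f η)))
    + Ksc * ∑ x : Tor d N, cG (obs η x) * (f (flipT η x) - f η)
section Expectation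

open MeasureTheory Measure

variable {d : ℕ}

/-- The Bernoulli measure on `Bool` giving mass `ρ` to `true`. -/
def bernMeasure (ρ : ℝ) : Measure Bool :=
  ENNReal.ofReal ρ • dirac true + ENNReal.ofReal (1 - ρ) • dirac false

lemma isProbabilityMeasure_bernMeasure {ρ : ℝ} (h0 : 0 ≤ ρ) (h1 : ρ ≤ 1) :
    IsProbabilityMeasure (bernMeasure ρ) := by
  constructor
  simp only [bernMeasure, Measure.coe_add, Measure.coe_smul, Pi.add_apply, Pi.smul_apply, measure_univ,
    smul_eq_mul, mul_one]
  rw [← ENNReal.ofReal_add h0 (sub_nonneg.2 h1)]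
  simp

lemma bernMeasure_real_singleton {ρ : ℝ} (h0 : 0 ≤ ρ) (h1 : ρ ≤ 1) (b : Bool) :
    (bernMeasure ρ).real {b} = bern ρ b := by
  cases b <;> simp [bernMeasure, bern, measureReal_def, h0, h1]

lemma bExp_eq_integral {ρ : ℝ} (h0 : 0 ≤ ρ) (h1 : ρ ≤ 1) {S : Finset (Fin d → ℤ)}
    {f : ((Fin d → ℤ) → Bool) → ℝ} (hf : IsLocal S f) :
    bExp ρ S f = ∫ η, f η ∂infinitePi fun _ : Fin d → ℤ => bernMeasure ρ := by
  have := isProbabilityMeasure_bernMeasure h0 h1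
  set g : ({x // x ∈ S} → Bool) → ℝ :=
    fun ζ => f fun z => if hz : z ∈ S then ζ ⟨z, hz⟩ else false with hg
  have hfg : f = fun η => g (S.restrict η) := by
    funext η
    exact hf _ _ fun x hx => by simp [hx]
  have hf_int : ∫ η, f η ∂infinitePi (fun _ : Fin d → ℤ => bernMeasure ρ)
      = ∫ ζ, g ζ ∂Measure.pi fun _ : {x // x ∈ S} => bernMeasure ρ := by
    rw [hfg]
    exact integral_restrict_infinitePi _ Measurable.of_discrete.aestronglyMeasurable
  rw [hf_int, integral_fintype .of_finite]
  refine Finset.sum_congr rfl fun ζ _ => ?_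
  rw [smul_eq_mul, measureReal_def, pi_singleton, ENNReal.toReal_prod]
  simp_rw [← measureReal_def, bernMeasure_real_singleton h0 h1, hg]

lemma IsLocal.mono {S T : Finset (Fin d → ℤ)} {f : ((Fin d → ℤ) → Bool) → ℝ}
    (hf : IsLocal S f) (hST : S ⊆ T) : IsLocal T f :=
  fun η η' H => hf η η' fun x hx => H x (hST hx)

lemma IsLocal.mul {S : Finset (Fin d → ℤ)} {f g : ((Fin d → ℤ) → Bool) → ℝ}
    (hf : IsLocal S f) (hg : IsLocal S g) : IsLocal S fun η => f η * g η :=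
  fun η η' H => by simp only [hf η η' H, hg η η' H]

lemma isLocal_coord {S : Finset (Fin d → ℤ)} {x : Fin d → ℤ} (hx : x ∈ S) (φ : Bool → ℝ) :
    IsLocal S fun η => φ (η x) :=
  fun η η' H => by simp only [H x hx]

/-- Bernoulli expectations are invariant under permutations of the sites. -/
lemma bExp_comp_equiv {ρ : ℝ} (h0 : 0 ≤ ρ) (h1 : ρ ≤ 1) {S T : Finset (Fin d → ℤ)}
    {f : ((Fin d → ℤ) → Bool) → ℝ} (hf : IsLocal S f) (σ : (Fin d → ℤ) ≃ (Fin d → ℤ))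
    (hST : ∀ x ∈ S, σ x ∈ T) :
    bExp ρ T (fun η => f fun z => η (σ z)) = bExp ρ S f := by
  have := isProbabilityMeasure_bernMeasure h0 h1
  have hT : IsLocal T fun η => f fun z => η (σ z) :=
    fun η η' H => hf _ _ fun x hx => H _ (hST x hx)
  rw [bExp_eq_integral h0 h1 hf, bExp_eq_integral h0 h1 hT]
  conv_rhs =>
    rw [← infinitePi_map_piCongrLeft (fun _ => bernMeasure ρ) σ.symm, integral_map_equiv]
  refine integral_congr_ae (.of_forall fun η => congrArg f ?_)
  funext z
  simp [MeasurableEquiv.piCongrLeft, Equiv.piCongrLeft, Equiv.piCongrLeft']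

lemma bExp_mono {ρ : ℝ} (h0 : 0 ≤ ρ) (h1 : ρ ≤ 1) {S T : Finset (Fin d → ℤ)}
    {f : ((Fin d → ℤ) → Bool) → ℝ} (hf : IsLocal S f) (hST : S ⊆ T) :
    bExp ρ T f = bExp ρ S f :=
  bExp_comp_equiv h0 h1 hf (Equiv.refl _) fun _ hx => hST hx

lemma bExp_sub (ρ : ℝ) (S : Finset (Fin d → ℤ)) (f g : ((Fin d → ℤ) → Bool) → ℝ) :
    bExp ρ S (fun η => f η - g η) = bExp ρ S f - bExp ρ S g := by
  simp [bExp, mul_sub, Finset.sum_sub_distrib]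

lemma bExp_neg (ρ : ℝ) (S : Finset (Fin d → ℤ)) (f : ((Fin d → ℤ) → Bool) → ℝ) :
    bExp ρ S (fun η => -f η) = -bExp ρ S f := by
  simp [bExp]

lemma hasDerivAt_bern {ρ : ℝ} (h0 : 0 < ρ) (h1 : ρ < 1) (b : Bool) :
    HasDerivAt (fun r => bern r b) (bern ρ b * ((bval b - ρ) / (ρ * (1 - ρ)))) ρ := by
  have h1' : 1 - ρ ≠ 0 := by linarith
  cases b
  · simp only [bern, bval, Bool.false_eq_true, if_false]
    refine ((hasDerivAt_id ρ).const_sub 1).congr_deriv ?_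
    field_simp
    ring
  · simp only [bern, bval, if_true]
    refine (hasDerivAt_id ρ).congr_deriv ?_
    field_simp

lemma hasDerivAt_bExp {ρ : ℝ} (h0 : 0 < ρ) (h1 : ρ < 1) (S : Finset (Fin d → ℤ))
    (f : ((Fin d → ℤ) → Bool) → ℝ) :
    HasDerivAt (fun r => bExp r S f)
      ((∑ x ∈ S, bExp ρ S fun η => f η * (bval (η x) - ρ)) / (ρ * (1 - ρ))) ρ := by
  have key : ∀ ζ : {x // x ∈ S} → Bool,
      HasDerivAt (fun r => ∏ x, bern r (ζ x))
        (∑ x, (∏ y, bern ρ (ζ y)) * ((bval (ζ x) - ρ) / (ρ * (1 - ρ)))) ρ := by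
    intro ζ
    refine (HasDerivAt.fun_finsetProd (u := Finset.univ)
      fun x _ => hasDerivAt_bern h0 h1 (ζ x)).congr_deriv ?_
    refine Finset.sum_congr rfl fun x _ => ?_
    rw [← Finset.prod_erase_mul Finset.univ (fun y => bern ρ (ζ y)) (Finset.mem_univ x), smul_eq_mul, mul_assoc]
  refine (HasDerivAt.fun_sum (u := Finset.univ) fun ζ _ =>
    (key ζ).mul_const (f fun z => if hz : z ∈ S then ζ ⟨z, hz⟩ else false)).congr_deriv ?_
  rw [← Finset.sum_coe_sort S]
  simp only [bExp, Finset.sum_div, Finset.sum_mul]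
  conv_rhs => rw [Finset.sum_comm]
  refine Finset.sum_congr rfl fun ζ _ => Finset.sum_congr rfl fun x _ => ?_
  simp only [Subtype.coe_eta, x.2, dif_pos]
  ring

/-- A local function is uncorrelated with the sites it does not depend on. -/
lemma bExp_mul_centered_eq_zero {ρ : ℝ} (h0 : 0 < ρ) (h1 : ρ < 1) {S : Finset (Fin d → ℤ)}
    {f : ((Fin d → ℤ) → Bool) → ℝ} (hf : IsLocal S f) {x : Fin d → ℤ} (hx : x ∉ S) :
    bExp ρ (insert x S) (fun η => f η * (bval (η x) - ρ)) = 0 := by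
  have hev : (fun r => bExp r (insert x S) f) =ᶠ[nhds ρ] fun r => bExp r S f := by
    filter_upwards [Ioo_mem_nhds h0 h1] with r hr
    exact bExp_mono hr.1.le hr.2.le hf (Finset.subset_insert _ _)
  have hder := (hasDerivAt_bExp h0 h1 (insert x S) f).unique
    ((hasDerivAt_bExp h0 h1 S f).congr_of_eventuallyEq hev)
  have hχ : ρ * (1 - ρ) ≠ 0 := (mul_pos h0 (sub_pos.2 h1)).ne'
  rw [div_left_inj' hχ, Finset.sum_insert hx] at hder
  have hS : ∀ y ∈ S, bExp ρ (insert x S) (fun η => f η * (bval (η y) - ρ))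
      = bExp ρ S (fun η => f η * (bval (η y) - ρ)) := fun y hy =>
    bExp_mono h0.le h1.le (hf.mul (isLocal_coord hy fun b => bval b - ρ))
      (Finset.subset_insert _ _)
  rw [Finset.sum_congr rfl hS] at hder
  linarith

lemma exchL_eq_comp_swap (η : (Fin d → ℤ) → Bool) (x y : Fin d → ℤ) :
    exchL η x y = fun z => η (Equiv.swap x y z) := by
  funext z
  simp only [exchL, Function.update_apply, Equiv.swap_apply_def]
  split_ifs <;> simp_all

lemma bExp_exchL {ρ : ℝ} (h0 : 0 ≤ ρ) (h1 : ρ ≤ 1) {T : Finset (Fin d → ℤ)}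
    {f : ((Fin d → ℤ) → Bool) → ℝ} (hf : IsLocal T f) {x y : Fin d → ℤ}
    (hx : x ∈ T) (hy : y ∈ T) :
    bExp ρ T (fun η => f (exchL η x y)) = bExp ρ T f := by
  simp only [exchL_eq_comp_swap]
  refine bExp_comp_equiv h0 h1 hf _ fun z hz => ?_
  rw [Equiv.swap_apply_def]
  split_ifs <;> assumption

end Expectation



/-- Green–Kubo formula.  If the exchange rate `c = c_{0,e_i}` is a positive
local function which is invariant under exchanging the values at `0` and `e_i`, and the
gradient condition `c(η)(η_0 - η_{e_i}) = h(η) - h(τ_{e_i} η)` holds for a local `h`, then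
`P(ρ) := E^{ν_ρ}[h]` satisfies `P'(ρ) = (2ρ(1-ρ))⁻¹ E^{ν_ρ}[c(η)(η_0 - η_{e_i})²]`. -/
theorem stmt_0 (d : ℕ) (hd : 1 ≤ d) (i : Fin d)
    (Sc Sh : Finset (Fin d → ℤ))
    (c h : ((Fin d → ℤ) → Bool) → ℝ)
    (hc_loc : IsLocal Sc c) (hh_loc : IsLocal Sh h)
    (hc_pos : ∀ η, 0 < c η)
    (hc_exch : ∀ η, c (exchL η 0 (zvec d i)) = c η)
    (hgrad : ∀ η, c η * (bval (η 0) - bval (η (zvec d i)))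
        = h η - h (transl (zvec d i) η))
    (P : ℝ → ℝ) (hP : ∀ ρ, P ρ = bExp ρ Sh h)
    (ρ : ℝ) (hρ : ρ ∈ Set.Ioo (0:ℝ) 1) :
    deriv P ρ
      = 1 / (2 * ρ * (1 - ρ))
          * bExp ρ (Sc ∪ {0, zvec d i})
              (fun η => c η * (bval (η 0) - bval (η (zvec d i)))^2) := by


  obtain ⟨h0, h1⟩ := hρ
  set e := zvec d i with he
  have hei : e i = 1 := by simp [he, zvec]
  have he0 : e ≠ 0 := fun H => by simp [H] at hei
  set j : ((Fin d → ℤ) → Bool) → ℝ := fun η => c η * (bval (η 0) - bval (η e)) with hj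
  set q : ((Fin d → ℤ) → Bool) → ℝ := fun η => c η * (bval (η 0) - bval (η e)) ^ 2 with hq
  set U := Sc ∪ {0, e} with hU
  set T := U ∪ (Sh ∪ Sh.image (· + e)) with hT
  have hUT : U ⊆ T := Finset.subset_union_left
  have hShT : Sh ⊆ T := Finset.subset_union_left.trans Finset.subset_union_right
  have hImT : Sh.image (· + e) ⊆ T := Finset.subset_union_right.trans Finset.subset_union_right
  have h0U : 0 ∈ U := by simp [hU]
  have heU : e ∈ U := by simp [hU]
  have hdiff : IsLocal U fun η => bval (η 0) - bval (η e) :=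
    fun η η' H => by simp only [H 0 h0U, H e heU]
  have hjU : IsLocal U j := (hc_loc.mono Finset.subset_union_left).mul hdiff
  have hqU : IsLocal U q := by
    refine (hc_loc.mono Finset.subset_union_left).mul fun η η' H => ?_
    simp only [hdiff η η' H]
  have hqT : bExp ρ T q = bExp ρ U q := bExp_mono h0.le h1.le hqU hUT
  have hjx : ∀ x ∈ T, IsLocal T fun η => j η * (bval (η x) - ρ) := fun x hx =>
    (hjU.mono hUT).mul (isLocal_coord hx fun b => bval b - ρ)
  have hjexch : ∀ η, j (exchL η 0 e) = -j η := by
    intro η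
    simp only [hj, hc_exch]
    simp [exchL, he0.symm]
    ring
  set D : (Fin d → ℤ) → ℝ := fun x => bExp ρ T fun η => j η * (bval (η x) - ρ) with hD
  set K : (Fin d → ℤ) → ℝ :=
    fun x => bExp ρ (insert x Sh) fun η => h η * (bval (η x) - ρ) with hK
  have hD_ne : ∀ x ∈ T, x ≠ 0 → x ≠ e → D x = 0 := by
    intro x hx hx0 hxe
    have H := bExp_exchL h0.le h1.le (hjx x hx) (hUT h0U) (hUT heU)
    have H' : (fun η => j (exchL η 0 e) * (bval (exchL η 0 e x) - ρ))
        = fun η => -(j η * (bval (η x) - ρ)) := by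
      funext η
      rw [hjexch]
      simp [exchL, hx0, hxe]
    rw [H', bExp_neg] at H
    simp only [hD]
    linarith
  have hD_e : D e = -(1 / 2) * bExp ρ U q := by
    have H := bExp_exchL h0.le h1.le (hjx e (hUT heU)) (hUT h0U) (hUT heU)
    have H' : (fun η => j (exchL η 0 e) * (bval (exchL η 0 e e) - ρ))
        = fun η => -q η - j η * (bval (η e) - ρ) := by
      funext η
      rw [hjexch]
      simp only [exchL, Function.update_self, hj, hq]
      ring
    rw [H', bExp_sub, bExp_neg, hqT] at H
    simp only [hD]
    linarith
  have hK_loc : ∀ x, IsLocal (insert x Sh) fun η => h η * (bval (η x) - ρ) := fun x =>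
    (hh_loc.mono (Finset.subset_insert _ _)).mul
      (isLocal_coord (Finset.mem_insert_self _ _) fun b => bval b - ρ)
  have hK_zero : ∀ x, x ∉ Sh → K x = 0 := fun x hx =>
    bExp_mul_centered_eq_zero h0 h1 hh_loc hx
  have hDK : ∀ x ∈ T, D x = K x - K (x - e) := by
    intro x hx
    have hfun : (fun η => j η * (bval (η x) - ρ)) = fun η =>
        h η * (bval (η x) - ρ) - h (transl e η) * (bval (η x) - ρ) := by
      funext η
      rw [← sub_mul, ← hgrad]
    simp only [hD, hfun]
    rw [bExp_sub, bExp_mono h0.le h1.le (hK_loc x) (Finset.insert_subset hx hShT)]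
    congr 1
    simp only [hK]
    rw [← bExp_comp_equiv (T := T) h0.le h1.le (hK_loc (x - e)) (Equiv.addRight e)]
    · simp only [Equiv.coe_addRight, sub_add_cancel]
      rfl
    · intro y hy
      rcases Finset.mem_insert.1 hy with rfl | hy
      · simpa using hx
      · exact hImT (Finset.mem_image_of_mem (· + e) hy)
  have hsum_D : ∑ x ∈ T, (x i : ℝ) * D x = D e := by
    rw [Finset.sum_eq_single e]
    · simp [hei]
    · intro x hx hxe
      rcases eq_or_ne x 0 with rfl | hx0
      · simp
      · rw [hD_ne x hx hx0 hxe, mul_zero]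
    · exact fun H => absurd (hUT heU) H
  have hsum_K : ∑ x ∈ T, (x i : ℝ) * K x = ∑ x ∈ Sh, (x i : ℝ) * K x :=
    (Finset.sum_subset hShT fun x _ hx => by rw [hK_zero x hx, mul_zero]).symm
  have hsum_K' : ∑ x ∈ T, (x i : ℝ) * K (x - e) = ∑ x ∈ Sh, ((x i : ℝ) + 1) * K x := by
    rw [← Finset.sum_subset hImT, Finset.sum_image fun _ _ _ _ H => add_right_cancel H]
    · simp [hei]
    · intro x _ hx
      rw [hK_zero, mul_zero]
      exact fun H => hx (Finset.mem_image.2 ⟨_, H, sub_add_cancel x e⟩)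
  have hmain : ∑ x ∈ Sh, K x = 1 / 2 * bExp ρ U q := by
    have H : ∑ x ∈ T, (x i : ℝ) * D x
        = ∑ x ∈ T, (x i : ℝ) * K x - ∑ x ∈ T, (x i : ℝ) * K (x - e) := by
      rw [← Finset.sum_sub_distrib]
      exact Finset.sum_congr rfl fun x hx => by rw [hDK x hx, mul_sub]
    rw [hsum_D, hsum_K, hsum_K', hD_e, ← Finset.sum_sub_distrib] at H
    have H' : ∑ x ∈ Sh, ((x i : ℝ) * K x - ((x i : ℝ) + 1) * K x) = -∑ x ∈ Sh, K x := by
      rw [← Finset.sum_neg_distrib]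
      exact Finset.sum_congr rfl fun x _ => by ring
    linarith
  rw [funext hP, (hasDerivAt_bExp h0 h1 Sh h).deriv]
  have hSh : ∀ x ∈ Sh, (bExp ρ Sh fun η => h η * (bval (η x) - ρ)) = K x := fun x hx => by
    simp only [hK, Finset.insert_eq_of_mem hx]
  rw [Finset.sum_congr rfl hSh, hmain]
  have : 1 - ρ ≠ 0 := by linarith
  field_simp

end
end GK
end

section
/- Fix d ≥ 1, i ∈ {1,…,d} and α ∈ ℝ. Define c(η) := 1 + α(η_{−e_i} + η_{2e_i}) and h(η) := (α+1)η_0 + α(η_{−e_i} − η_0)(η_0 − η_{e_i}) for η ∈ X = {0,1}^{ℤ^d}. Then for every η ∈ X, c(η)(η_0 − η_{e_i}) = h(η) − h(τ_{e_i}η), i.e. the exchange rate c_{0,e_i} = c satisfies the gradient condition with local function h_i = h. -/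
namespace GK

open Finset

noncomputable section

/-- The exchange rate `c_{0,e_i}(η) = 1 + α(η_{-e_i} + η_{2e_i})` satisfies the
gradient condition with `h_i(η) = (α+1)η_0 + α(η_{-e_i} - η_0)(η_0 - η_{e_i})`. -/
theorem stmt_2 (d : ℕ) (hd : 1 ≤ d) (i : Fin d) (α : ℝ)
    (c h : ((Fin d → ℤ) → Bool) → ℝ)
    (hc : ∀ η, c η = 1 + α * (bval (η (-zvec d i)) + bval (η (zvec d i + zvec d i))))
    (hh : ∀ η, h η = (α + 1) * bval (η 0)
        + α * (bval (η (-zvec d i)) - bval (η 0)) * (bval (η 0) - bval (η (zvec d i)))) :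
    ∀ η, c η * (bval (η 0) - bval (η (zvec d i))) = h η - h (transl (zvec d i) η) := by
  intro η
  have h0 : transl (zvec d i) η 0 = η (zvec d i) := by simp [transl]
  have hneg : transl (zvec d i) η (-zvec d i) = η 0 := by simp [transl]
  have hpos : transl (zvec d i) η (zvec d i) = η (zvec d i + zvec d i) := rfl
  have hsq : ∀ b, bval b * bval b = bval b := fun b => by cases b <;> simp [bval]
  rw [hc, hh, hh, h0, hneg, hpos]
  linear_combination α * hsq (η 0) - α * hsq (η (zvec d i))

end
end GK
end

section
/- Let N be large enough, X_N = {0,1}^{T_N^d}, and L_N = N² L_K + K L_G with exchange rates c_{x,y} > 0 (|x−y|=1, c_{x,y} = c_{y,x}) and flip rates c_x ≥ 0. Let m be a probability measure on X_N with full support. Let (ν_t)_{t≥0} be a family of probability measures on X_N with full support such that ψ_t := dν_t/dm is differentiable in t, and let (μ_t)_{t≥0} be a family of probability measures on X_N with full support, differentiable in t, solving the forward Kolmogorov equation d/dt Σ_η μ_t(η) f(η) = Σ_η (L_N f)(η) μ_t(η) for every function f : X_N → ℝ. Then for every t > 0, (d/dt) H(μ_t|ν_t) ≤ − D_N(√(dμ_t/dν_t);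 ν_t) + Σ_η ( L_N^{*,ν_t}𝟙(η) − ∂_t log ψ_t(η) ) μ_t(η). -/
namespace GK

open Finset

noncomputable section

theorem mul_log_sub_log_le {a b : ℝ} (ha : 0 < a) (hb : 0 < b) :
    a * (Real.log b - Real.log a) ≤ -(√b - √a) ^ 2 + (b - a) := by
  have hsa := Real.sqrt_pos.2 ha
  have hsb := Real.sqrt_pos.2 hb
  have hlog : Real.log b - Real.log a = 2 * Real.log (√b / √a) := by
    rw [Real.log_div hsb.ne' hsa.ne', Real.log_sqrt hb.le, Real.log_sqrt ha.le]
    ring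
  have hle : Real.log (√b / √a) ≤ √b / √a - 1 :=
    Real.log_le_sub_one_of_pos (div_pos hsb hsa)
  have ha2 := Real.sq_sqrt ha.le
  have hb2 := Real.sq_sqrt hb.le
  calc a * (Real.log b - Real.log a) ≤ a * (2 * (√b / √a - 1)) := by
        rw [hlog]
        gcongr
    _ = √a ^ 2 * (2 * (√b / √a - 1)) := by rw [ha2]
    _ = 2 * √a * (√b - √a) := by field_simp
    _ = -(√b - √a) ^ 2 + (√b ^ 2 - √a ^ 2) := by ring
    _ = _ := by rw [ha2, hb2]

theorem nnSum_mono {d N : ℕ} [NeZero N] {F G : Tor d N → Tor d N → ℝ}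
    (h : ∀ x i, F x (x + uvec d N i) ≤ G x (x + uvec d N i) ∧
      F x (x - uvec d N i) ≤ G x (x - uvec d N i)) :
    nnSum d N F ≤ nnSum d N G :=
  sum_le_sum fun x _ => sum_le_sum fun i _ => add_le_add (h x i).1 (h x i).2

theorem nnSum_add {d N : ℕ} [NeZero N] (F G : Tor d N → Tor d N → ℝ) :
    nnSum d N (fun x y => F x y + G x y) = nnSum d N F + nnSum d N G := by
  simp only [nnSum, sum_add_distrib]
  ring

theorem mul_nnSum {d N : ℕ} [NeZero N] (a : ℝ) (F : Tor d N → Tor d N → ℝ) :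
    a * nnSum d N F = nnSum d N (fun x y => a * F x y) := by
  simp only [nnSum, mul_sum, mul_add]

theorem sum_nnSum {d N : ℕ} [NeZero N] {ι : Type*} [Fintype ι]
    (F : ι → Tor d N → Tor d N → ℝ) :
    ∑ j, nnSum d N (F j) = nnSum d N (fun x y => ∑ j, F j x y) := by
  simp only [nnSum, ← sum_add_distrib]
  rw [sum_comm]
  exact sum_congr rfl fun x _ => sum_comm

theorem LK_eq_nnSum {d N : ℕ} [NeZero N] (cc : Tor d N → Tor d N → Conf d N → ℝ)
    (f : Conf d N → ℝ) (η : Conf d N) :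
    LK d N cc f η = (1 / 2) * nnSum d N (fun x y => cc x y η * (f (exchT η x y) - f η)) := rfl

theorem mul_LK_log_le {d N : ℕ} [NeZero N] {cc : Tor d N → Tor d N → Conf d N → ℝ}
    (hcc : ∀ x i η, 0 < cc x (x + uvec d N i) η ∧ 0 < cc x (x - uvec d N i) η)
    {h : Conf d N → ℝ} (hh : ∀ η, 0 < h η) (η : Conf d N) :
    h η * LK d N cc (fun ζ => Real.log (h ζ)) η ≤
      -((1 / 2) * nnSum d N fun x y => cc x y η * (√(h (exchT η x y)) - √(h η)) ^ 2)
        + LK d N cc h η := by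
  have key (x y) (hc : 0 < cc x y η) :
      h η * (cc x y η * (Real.log (h (exchT η x y)) - Real.log (h η))) ≤
        -1 * (cc x y η * (√(h (exchT η x y)) - √(h η)) ^ 2) +
          cc x y η * (h (exchT η x y) - h η) := by
    linarith [mul_le_mul_of_nonneg_left
      (mul_log_sub_log_le (hh η) (hh (exchT η x y))) hc.le]
  have hsum := nnSum_mono
    (F := fun x y => h η * (cc x y η * (Real.log (h (exchT η x y)) - Real.log (h η))))
    (G := fun x y => -1 * (cc x y η * (√(h (exchT η x y)) - √(h η)) ^ 2) +
      cc x y η * (h (exchT η x y) - h η)) fun x i =>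
    ⟨key x _ (hcc x i η).1, key x _ (hcc x i η).2⟩
  rw [nnSum_add, ← mul_nnSum, ← mul_nnSum] at hsum
  rw [LK_eq_nnSum, LK_eq_nnSum]
  linarith

theorem mul_LG_log_le {d N : ℕ} [NeZero N] {cG : Tor d N → Conf d N → ℝ}
    (hcG : ∀ x η, 0 ≤ cG x η) {h : Conf d N → ℝ} (hh : ∀ η, 0 < h η) (η : Conf d N) :
    h η * LG d N cG (fun ζ => Real.log (h ζ)) η ≤
      -(∑ x, cG x η * (√(h (flipT η x)) - √(h η)) ^ 2) + LG d N cG h η := by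
  simp only [LG, mul_sum, ← sum_neg_distrib, ← sum_add_distrib]
  refine sum_le_sum fun x _ => ?_
  linarith [mul_le_mul_of_nonneg_left
    (mul_log_sub_log_le (hh η) (hh (flipT η x))) (hcG x η)]

/-- Integrated form of `mul_LK_log_le` and `mul_LG_log_le`. -/
theorem sum_generator_log_le {d N : ℕ} [NeZero N] {K : ℝ} (hK : 0 ≤ K)
    {cc : Tor d N → Tor d N → Conf d N → ℝ}
    (hcc : ∀ x i η, 0 < cc x (x + uvec d N i) η ∧ 0 < cc x (x - uvec d N i) η)
    {cG : Tor d N → Conf d N → ℝ} (hcG : ∀ x η, 0 ≤ cG x η)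
    {h ν : Conf d N → ℝ} (hh : ∀ η, 0 < h η) (hν : ∀ η, 0 < ν η) :
    ∑ η, ((N : ℝ) ^ 2 * LK d N cc (fun ζ => Real.log (h ζ)) η +
        K * LG d N cG (fun ζ => Real.log (h ζ)) η) * (h η * ν η) ≤
      -(2 * (N : ℝ) ^ 2 * ((1 / 4) * nnSum d N (fun x y => ∑ η,
            cc x y η * (√(h (exchT η x y)) - √(h η)) ^ 2 * ν η))
          + K * ∑ x, ∑ η, cG x η * (√(h (flipT η x)) - √(h η)) ^ 2 * ν η)
        + ∑ η, ((N : ℝ) ^ 2 * LK d N cc h η + K * LG d N cG h η) * ν η := by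
  have hKaw : nnSum d N (fun x y => ∑ η,
        cc x y η * (√(h (exchT η x y)) - √(h η)) ^ 2 * ν η) =
      ∑ η, ν η * nnSum d N fun x y => cc x y η * (√(h (exchT η x y)) - √(h η)) ^ 2 := by
    simp only [mul_nnSum, sum_nnSum]
    simp only [mul_comm (ν _)]
  have hGla : ∑ x, ∑ η, cG x η * (√(h (flipT η x)) - √(h η)) ^ 2 * ν η =
      ∑ η, ν η * ∑ x, cG x η * (√(h (flipT η x)) - √(h η)) ^ 2 := by
    rw [sum_comm]
    simp only [mul_comm (ν _), sum_mul]
  rw [hKaw, hGla]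
  simp only [mul_sum (s := (univ : Finset (Conf d N))), ← sum_add_distrib, ← sum_neg_distrib]
  refine sum_le_sum fun η _ => ?_
  have hLK := mul_le_mul_of_nonneg_left (mul_LK_log_le hcc hh η)
    (mul_nonneg (hν η).le (sq_nonneg (N : ℝ)))
  have hLG := mul_le_mul_of_nonneg_left (mul_LG_log_le hcG hh η) (mul_nonneg (hν η).le hK)
  linarith

theorem hasDerivAt_mul_log_div {u v : ℝ → ℝ} {u' v' t : ℝ} (hu : HasDerivAt u u' t)
    (hv : HasDerivAt v v' t) (hut : 0 < u t) (hvt : 0 < v t) :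
    HasDerivAt (fun s => u s * Real.log (u s / v s))
      (u' * Real.log (u t / v t) + u' - v' / v t * u t) t := by
  have hdiv := (hu.fun_div hv hvt.ne').log (div_pos hut hvt).ne'
  refine (hu.fun_mul hdiv).congr_deriv ?_
  field_simp
  ring

/-- Upper bound on entropy production, Theorem `thm:4.2`.
For the Glauber–Kawasaki generator `L_N = N²L_K + K L_G`, a reference measure `m`, a
differentiable family of full-support measures `ν_t` with density `ψ_t = dν_t/dm`, and the
law `μ_t` of the process (solving the forward Kolmogorov equation), the entropy production
satisfies
`d/dt H(μ_t|ν_t) ≤ -D_N(√(dμ_t/dν_t); ν_t) + Σ_η (L_N^{*,ν_t}𝟙(η) - ∂_t log ψ_t(η)) μ_t(η)`.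
Here `g t` is the adjoint applied to `𝟙`, characterized by the stated identity, and
`∂_t log ψ_t(η) = ψdot t η / ψ_t(η)`. -/
theorem stmt_6 (d N : ℕ) [NeZero N] (hN : 1 ≤ N) (K : ℝ) (hK : 1 ≤ K)
    (cc : Tor d N → Tor d N → Conf d N → ℝ)
    (hpos : ∀ (x : Tor d N) (i : Fin d) (η : Conf d N),
      0 < cc x (x + uvec d N i) η ∧ 0 < cc x (x - uvec d N i) η)
    (hsym : ∀ x y η, cc x y η = cc y x η)
    (cG : Tor d N → Conf d N → ℝ) (hcG : ∀ x η, 0 ≤ cG x η)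
    (m : Conf d N → ℝ) (hm_pos : ∀ η, 0 < m η) (hm1 : ∑ η : Conf d N, m η = 1)
    (ν μ : ℝ → Conf d N → ℝ)
    (hν_pos : ∀ t ∈ Set.Ici (0:ℝ), ∀ η, 0 < ν t η)
    (hν1 : ∀ t ∈ Set.Ici (0:ℝ), ∑ η : Conf d N, ν t η = 1)
    (hμ_pos : ∀ t ∈ Set.Ici (0:ℝ), ∀ η, 0 < μ t η)
    (hμ1 : ∀ t ∈ Set.Ici (0:ℝ), ∑ η : Conf d N, μ t η = 1)
    (ψdot : ℝ → Conf d N → ℝ)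
    (hψ : ∀ (η : Conf d N), ∀ t ∈ Set.Ici (0:ℝ),
      HasDerivWithinAt (fun s => ν s η / m η) (ψdot t η) (Set.Ici 0) t)
    (hKol : ∀ (f : Conf d N → ℝ), ∀ t ∈ Set.Ici (0:ℝ),
      HasDerivWithinAt (fun s => ∑ η : Conf d N, μ s η * f η)
        (∑ η : Conf d N, ((N:ℝ)^2 * LK d N cc f η + K * LG d N cG f η) * μ t η)
        (Set.Ici 0) t)
    (g : ℝ → Conf d N → ℝ)
    (hg : ∀ t ∈ Set.Ici (0:ℝ), ∀ f : Conf d N → ℝ,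
      ∑ η : Conf d N, ((N:ℝ)^2 * LK d N cc f η + K * LG d N cG f η) * ν t η
        = ∑ η : Conf d N, g t η * f η * ν t η)
    (t : ℝ) (ht : 0 < t) (D : ℝ)
    (hD : HasDerivAt (fun s => relEnt (μ s) (ν s)) D t) :
    D ≤ -(2 * (N:ℝ)^2 * ((1/4) * nnSum d N (fun x y => ∑ η : Conf d N,
            cc x y η * (Real.sqrt (μ t (exchT η x y) / ν t (exchT η x y))
              - Real.sqrt (μ t η / ν t η))^2 * ν t η))
          + K * ∑ x : Tor d N, ∑ η : Conf d N,
              cG x η * (Real.sqrt (μ t (flipT η x) / ν t (flipT η x))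
                - Real.sqrt (μ t η / ν t η))^2 * ν t η)
        + ∑ η : Conf d N, (g t η - ψdot t η / (ν t η / m η)) * μ t η := by
  have hnhds : Set.Ici (0 : ℝ) ∈ nhds t := Ici_mem_nhds ht
  have ht0 : t ∈ Set.Ici (0 : ℝ) := ht.le
  have hνt := hν_pos t ht0
  have hμt := hμ_pos t ht0
  have hK0 : 0 ≤ K := by linarith
  classical
  have hμ_deriv (η : Conf d N) : ∃ r, HasDerivAt (fun s => μ s η) r t :=
    ⟨_, by simpa [Pi.single_apply] using (hKol (Pi.single η 1) t ht0).hasDerivAt hnhds⟩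
  choose μdot hμdot using hμ_deriv
  have hforward (f : Conf d N → ℝ) : ∑ η, μdot η * f η =
      ∑ η, ((N : ℝ) ^ 2 * LK d N cc f η + K * LG d N cG f η) * μ t η :=
    (HasDerivAt.fun_sum fun η _ => (hμdot η).mul_const (f η)).unique
      ((hKol f t ht0).hasDerivAt hnhds)
  have hmass : ∑ η, μdot η = 0 := by
    simpa [LK, LG] using hforward fun _ => 1
  have hν_deriv (η : Conf d N) : HasDerivAt (fun s => ν s η) (ψdot t η * m η) t := by
    simpa [(hm_pos η).ne'] using ((hψ η t ht0).hasDerivAt hnhds).mul_const (m η)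
  have hD_eq : D = ∑ η, μdot η * Real.log (μ t η / ν t η)
      - ∑ η, ψdot t η / (ν t η / m η) * μ t η := by
    rw [hD.unique (HasDerivAt.fun_sum fun η _ =>
      hasDerivAt_mul_log_div (hμdot η) (hν_deriv η) (hμt η) (hνt η))]
    simp only [sum_sub_distrib, sum_add_distrib, hmass, add_zero, div_div_eq_mul_div]
  have hcancel (η : Conf d N) : μ t η / ν t η * ν t η = μ t η :=
    div_mul_cancel₀ _ (hνt η).ne'
  have hmain := sum_generator_log_le hK0 hpos hcG
    (fun η => div_pos (hμt η) (hνt η)) hνt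
  rw [hg t ht0] at hmain
  simp only [mul_assoc (g t _), hcancel] at hmain
  rw [hD_eq, hforward]
  simp only [sub_mul, sum_sub_distrib]
  linarith


end
end GK
end

section
/- Let N ≥ 1, u : T_N^d → (0,1), and let ν be the product measure on X_N with ν(η_x = 1) = u_x. Assume the exchange rates c_{x,y} : X_N → (0,∞) (for |x−y|=1) satisfy c_{x,y} = c_{y,x} and c_{x,y}(η^{x,y}) = c_{x,y}(η) for all η (i.e. c_{x,y} does not depend on (η_x, η_y)). Then the function L_K^{*,ν}𝟙 on X_N equals η ↦ −(1/2) Σ_{x,y ∈ T_N^d: |x−y|=1} ((u_y − u_x)² / (χ(u_x)χ(u_y))) c_{x,y}(η) η̄_x η̄_y + (1/2) Σ_{x,y ∈ T_N^d: |x−y|=1} c_{x,y}(η) ( η̄_x/χ(u_x) − η̄_y/χ(u_y) ) (u_y − u_x), where η̄_x := η_x − u_x. -/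
namespace GK

open Finset

noncomputable section

theorem exchT_self {d N : ℕ} (η : Conf d N) (x : Tor d N) : exchT η x x = η := by
  simp [exchT]

theorem exchT_exchT {d N : ℕ} (η : Conf d N) (x y : Tor d N) :
    exchT (exchT η x y) x y = η := by
  funext z
  simp only [exchT, Function.update_apply]
  split_ifs <;> simp_all

theorem sum_exchT {d N : ℕ} [NeZero N] (x y : Tor d N) (F : Conf d N → ℝ) :
    ∑ η : Conf d N, F (exchT η x y) = ∑ η : Conf d N, F η :=
  Equiv.sum_comp (Function.Involutive.toPerm (fun η : Conf d N => exchT η x y)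
    fun η => exchT_exchT η x y) F

theorem prodM_pos {d N : ℕ} [NeZero N] {u : Tor d N → ℝ}
    (hu : ∀ x, u x ∈ Set.Ioo (0:ℝ) 1) (η : Conf d N) : 0 < prodM d N u η := by
  refine Finset.prod_pos fun x _ => ?_
  obtain ⟨h0, h1⟩ := hu x
  unfold bern
  split_ifs <;> linarith

theorem prodM_eq_mul_prod_erase {d N : ℕ} [NeZero N] (u : Tor d N → ℝ) (η : Conf d N)
    {x y : Tor d N} (h : y ≠ x) :
    prodM d N u η = bern (u x) (η x) * (bern (u y) (η y) *
      ∏ z ∈ (univ.erase x).erase y, bern (u z) (η z)) := by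
  rw [prodM, Finset.mul_prod_erase (univ.erase x) (fun z => bern (u z) (η z)) (by simp [h]),
    Finset.mul_prod_erase univ (fun z => bern (u z) (η z)) (mem_univ x)]

/-- The relative increment of the product measure with means `u` under an exchange
of the values at `x` and `y`. -/
def exchIncr {d N : ℕ} (u : Tor d N → ℝ) (η : Conf d N) (x y : Tor d N) : ℝ :=
  -((u y - u x) ^ 2 / (chi (u x) * chi (u y)) * (bval (η x) - u x) * (bval (η y) - u y))
    + ((bval (η x) - u x) / chi (u x) - (bval (η y) - u y) / chi (u y)) * (u y - u x)

theorem bern_mul_bern_swap_sub {a b : ℝ} (ha : a ∈ Set.Ioo (0:ℝ) 1) (hb : b ∈ Set.Ioo (0:ℝ) 1)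
    (s t : Bool) :
    bern a t * bern b s - bern a s * bern b t = bern a s * bern b t *
      (-((b - a) ^ 2 / (chi a * chi b) * (bval s - a) * (bval t - b))
        + ((bval s - a) / chi a - (bval t - b) / chi b) * (b - a)) := by
  have h1 : a ≠ 0 := ha.1.ne'
  have h2 : 1 - a ≠ 0 := by linarith [ha.2]
  have h3 : b ≠ 0 := hb.1.ne'
  have h4 : 1 - b ≠ 0 := by linarith [hb.2]
  cases s <;> cases t <;> simp only [bern, bval, chi, if_true, Bool.false_eq_true, if_false] <;>
    field_simp <;> ring

theorem prodM_exchT_sub {d N : ℕ} [NeZero N] {u : Tor d N → ℝ}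
    (hu : ∀ x, u x ∈ Set.Ioo (0:ℝ) 1) (η : Conf d N) (x y : Tor d N) :
    prodM d N u (exchT η x y) - prodM d N u η = prodM d N u η * exchIncr u η x y := by
  rcases eq_or_ne y x with rfl | h
  · simp [exchT_self, exchIncr]
  have hx : exchT η x y x = η y := by simp [exchT, h.symm]
  have hy : exchT η x y y = η x := by simp [exchT]
  have hrest : ∏ z ∈ (univ.erase x).erase y, bern (u z) (exchT η x y z)
      = ∏ z ∈ (univ.erase x).erase y, bern (u z) (η z) := by
    refine Finset.prod_congr rfl fun z hz => ?_
    simp only [mem_erase, mem_univ, and_true] at hz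
    simp [exchT, hz.1, hz.2]
  rw [prodM_eq_mul_prod_erase u _ h, prodM_eq_mul_prod_erase u η h, hrest, hx, hy, exchIncr]
  linear_combination (∏ z ∈ (univ.erase x).erase y, bern (u z) (η z)) *
    bern_mul_bern_swap_sub (hu x) (hu y) (η x) (η y)

theorem sum_exchange_mul_prodM {d N : ℕ} [NeZero N] {u : Tor d N → ℝ}
    (hu : ∀ x, u x ∈ Set.Ioo (0:ℝ) 1) (x y : Tor d N) {c : Conf d N → ℝ}
    (hc : ∀ η, c (exchT η x y) = c η) (f : Conf d N → ℝ) :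
    ∑ η : Conf d N, c η * (f (exchT η x y) - f η) * prodM d N u η
      = ∑ η : Conf d N, c η * exchIncr u η x y * f η * prodM d N u η := by
  have h := sum_exchT x y fun η => c η * f η * prodM d N u (exchT η x y)
  simp only [exchT_exchT, hc] at h
  calc ∑ η : Conf d N, c η * (f (exchT η x y) - f η) * prodM d N u η
      = ∑ η : Conf d N, c η * f (exchT η x y) * prodM d N u η
          - ∑ η : Conf d N, c η * f η * prodM d N u η := by
        rw [← Finset.sum_sub_distrib]
        exact Finset.sum_congr rfl fun η _ => by ring
    _ = ∑ η : Conf d N, c η * exchIncr u η x y * f η * prodM d N u η := by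
        rw [h, ← Finset.sum_sub_distrib]
        exact Finset.sum_congr rfl fun η _ => by
          linear_combination c η * f η * prodM_exchT_sub hu η x y

theorem sum_LK_mul_prodM {d N : ℕ} [NeZero N] {u : Tor d N → ℝ}
    (hu : ∀ x, u x ∈ Set.Ioo (0:ℝ) 1) {cc : Tor d N → Tor d N → Conf d N → ℝ}
    (hrev : ∀ (x : Tor d N) (i : Fin d) (η : Conf d N),
      cc x (x + uvec d N i) (exchT η x (x + uvec d N i)) = cc x (x + uvec d N i) η
      ∧ cc x (x - uvec d N i) (exchT η x (x - uvec d N i)) = cc x (x - uvec d N i) η)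
    (f : Conf d N → ℝ) :
    ∑ η : Conf d N, LK d N cc f η * prodM d N u η
      = ∑ η : Conf d N, (1 / 2 * nnSum d N fun x y => cc x y η * exchIncr u η x y) * f η
          * prodM d N u η := by
  simp only [LK, nnSum, mul_assoc (1 / 2 : ℝ), ← Finset.mul_sum]
  congr 1
  simp only [Finset.sum_mul, add_mul]
  rw [Finset.sum_comm]
  conv_rhs => rw [Finset.sum_comm]
  refine Finset.sum_congr rfl fun x _ => ?_
  rw [Finset.sum_comm]
  conv_rhs => rw [Finset.sum_comm]
  refine Finset.sum_congr rfl fun i _ => ?_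
  simp only [Finset.sum_add_distrib]
  rw [sum_exchange_mul_prodM hu _ _ fun η => (hrev x i η).1,
    sum_exchange_mul_prodM hu _ _ fun η => (hrev x i η).2]

/-- Lemma `lem:4.4`: computation of `L_K^{*,ν}𝟙` for the product measure `ν`
with means `u`.  `g` denotes `L_K^{*,ν}𝟙`, characterized by the adjoint identity `hg`. -/
theorem stmt_7 (d N : ℕ) [NeZero N] (hN : 1 ≤ N)
    (u : Tor d N → ℝ) (hu : ∀ x, u x ∈ Set.Ioo (0:ℝ) 1)
    (cc : Tor d N → Tor d N → Conf d N → ℝ)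
    (hpos : ∀ (x : Tor d N) (i : Fin d) (η : Conf d N),
      0 < cc x (x + uvec d N i) η ∧ 0 < cc x (x - uvec d N i) η)
    (hsym : ∀ x y η, cc x y η = cc y x η)
    (hrev : ∀ (x : Tor d N) (i : Fin d) (η : Conf d N),
      cc x (x + uvec d N i) (exchT η x (x + uvec d N i)) = cc x (x + uvec d N i) η
      ∧ cc x (x - uvec d N i) (exchT η x (x - uvec d N i)) = cc x (x - uvec d N i) η)
    (g : Conf d N → ℝ)
    (hg : ∀ f : Conf d N → ℝ,
      ∑ η : Conf d N, LK d N cc f η * prodM d N u η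
        = ∑ η : Conf d N, g η * f η * prodM d N u η) :
    ∀ η : Conf d N,
      g η = -(1/2) * nnSum d N (fun x y =>
              ((u y - u x)^2 / (chi (u x) * chi (u y))) * cc x y η
                * (bval (η x) - u x) * (bval (η y) - u y))
            + (1/2) * nnSum d N (fun x y =>
              cc x y η
                * ((bval (η x) - u x) / chi (u x) - (bval (η y) - u y) / chi (u y))
                * (u y - u x)) := by
  intro η
  have h := hg (Pi.single η 1)
  rw [sum_LK_mul_prodM hu hrev] at h
  simp only [Pi.single_apply, mul_ite, mul_one, mul_zero, ite_mul, zero_mul,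
    Finset.sum_ite_eq', mem_univ, if_true] at h
  rw [← mul_right_cancel₀ (prodM_pos hu η).ne' h]
  simp only [nnSum, Finset.mul_sum, ← Finset.sum_add_distrib, exchIncr]
  refine Finset.sum_congr rfl fun x _ => Finset.sum_congr rfl fun i _ => ?_
  ring

end
end GK
end

section
/- (Equivalence of ensembles.) Let d ≥ 1, let h be a local function on X = {0,1}^{ℤ^d} with support contained in a finite box Λ_h, set β := 1/2, \tilde h(ρ) := E^{ν_ρ}[h] (a polynomial in ρ), and for u ∈ [0,1] set f^{(u)}(η) := h(η) − \tilde h(u) − \tilde h'(u)(η_0 − u), with \tilde f^{(u)}(ρ) := \tilde h(ρ) − \tilde h(u) − \tilde h'(u)(ρ − u). Let ℓ = ℓ(N) be any sequence with ℓ(N) → ∞ and ℓ(N)/N → 0. Then there exists C > 0 such that for all N large enough, for all x ∈ T_N^d, all u_x ∈ [0,1] and all η ∈ X_N: | E^{ν_β}[ τ_x f^{(u_x)} ∣ η_x^ℓ ](η) − \tilde f^{(u_x)}(η_x^ℓ) + (χ(η_x^ℓ)/(2ℓ_*^d)) (\tilde f^{(u_x)})''(η_x^ℓ) | ≤ C /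 ℓ^{2d}, where the conditional expectation is under the Bernoulli(1/2) product measure ν_β on X_N given the block average η_x^ℓ. -/
namespace GK

open Finset

noncomputable section

/-! ### Multilinear expansion of local functions -/

lemma exists_multilinear_coeff {ι : Type*} [Fintype ι] [DecidableEq ι] (H : (ι → Bool) → ℝ) :
    ∃ c : Finset ι → ℝ, ∀ p : ι → ℝ,
      ∑ ζ : ι → Bool, (∏ i, bern (p i) (ζ i)) * H ζ = ∑ A : Finset ι, c A * ∏ i ∈ A, p i := by
  refine ⟨fun A => ∑ ζ : ι → Bool, (∏ i ∈ A, (if ζ i then (1:ℝ) else -1)) *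
    (∏ i ∈ Aᶜ, (if ζ i then (0:ℝ) else 1)) * H ζ, fun p => ?_⟩
  have hb : ∀ (b : Bool) (q : ℝ),
      bern q b = (if b then (1:ℝ) else -1) * q + (if b then (0:ℝ) else 1) := by
    intro b q
    cases b <;> simp [bern]
    ring
  simp_rw [hb, Fintype.prod_add, Finset.sum_mul]
  rw [Finset.sum_comm]
  refine Finset.sum_congr rfl fun A _ => Finset.sum_congr rfl fun ζ _ => ?_
  rw [Finset.prod_mul_distrib]
  ring

lemma sum_bern_bval {ι : Type*} [Fintype ι] [DecidableEq ι] (H : (ι → Bool) → ℝ)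
    (σ : ι → Bool) : ∑ ζ : ι → Bool, (∏ i, bern (bval (σ i)) (ζ i)) * H ζ = H σ := by
  rw [Finset.sum_eq_single σ]
  · rw [Finset.prod_eq_one, one_mul]
    intro i _
    cases h : σ i <;> simp [bern, bval]
  · intro ζ _ hne
    obtain ⟨i, hi⟩ := Function.ne_iff.mp hne
    rw [Finset.prod_eq_zero (Finset.mem_univ i), zero_mul]
    cases h : σ i <;> cases h' : ζ i <;> simp_all [bern, bval]
  · simp

/-- A local function and its Bernoulli expectation share a multilinear expansion. -/
lemma IsLocal.exists_coeff {d : ℕ} {S : Finset (Fin d → ℤ)} {h : ((Fin d → ℤ) → Bool) → ℝ}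
    (hloc : IsLocal S h) :
    ∃ c : Finset {x // x ∈ S} → ℝ,
      (∀ ρ, bExp ρ S h = ∑ A, c A * ρ ^ A.card) ∧
      ∀ η, h η = ∑ A, c A * ∏ z ∈ A, bval (η z) := by
  obtain ⟨c, hc⟩ := exists_multilinear_coeff
    fun ζ : {x // x ∈ S} → Bool => h fun z => if hz : z ∈ S then ζ ⟨z, hz⟩ else false
  refine ⟨c, fun ρ => ?_, fun η => ?_⟩
  · simpa [bExp] using hc fun _ => ρ
  · rw [← hc fun z => bval (η z), sum_bern_bval _ fun z : {x // x ∈ S} => η z]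
    exact hloc _ _ fun x hx => by simp [hx]

lemma deriv_deriv_sum_pow {ι : Type*} (s : Finset ι) (c : ι → ℝ) (k : ι → ℕ) (ρ a b v : ℝ) :
    deriv (deriv fun ρ : ℝ => ∑ i ∈ s, c i * ρ ^ k i - a - b * (ρ - v)) ρ =
      ∑ i ∈ s, c i * (k i * ((k i - 1 : ℕ) * ρ ^ (k i - 1 - 1))) := by
  have h1 : (deriv fun ρ : ℝ => ∑ i ∈ s, c i * ρ ^ k i - a - b * (ρ - v)) =
      fun ρ => ∑ i ∈ s, c i * (k i * ρ ^ (k i - 1)) - b := by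
    ext ρ
    have h := ((HasDerivAt.fun_sum (u := s) fun i _ =>
      (hasDerivAt_pow (k i) ρ).const_mul (c i)).sub_const a).fun_sub
      (((hasDerivAt_id ρ).sub_const v).const_mul b)
    simpa using h.deriv
  rw [h1]
  have h := (HasDerivAt.fun_sum (u := s) fun i _ =>
    ((hasDerivAt_pow (k i - 1) ρ).const_mul (k i : ℝ)).const_mul (c i)).sub_const b
  exact h.deriv

/-! ### Correlations of an exchangeable weight with fixed particle number -/

/-- Unnormalised correlation function of the sites in `A` under the weight `w`. -/
def corr {α : Type*} [Fintype α] [DecidableEq α] (w : (α → Bool) → ℝ) (A : Finset α) : ℝ :=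
  ∑ ξ : α → Bool, (∏ y ∈ A, bval (ξ y)) * w ξ

section Exchangeable

variable {α : Type*} [Fintype α] [DecidableEq α] {B : Finset α} {w : (α → Bool) → ℝ}

lemma corr_insert_eq (hw : ∀ y ∈ B, ∀ y' ∈ B, ∀ ξ, w (ξ ∘ Equiv.swap y y') = w ξ)
    {A : Finset α} {y y' : α} (hyB : y ∈ B) (hyA : y ∉ A) (hyB' : y' ∈ B) (hyA' : y' ∉ A) :
    corr w (insert y A) = corr w (insert y' A) := by
  unfold corr
  rw [← Equiv.sum_comp ((Equiv.swap y y').arrowCongr (Equiv.refl Bool))]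
  refine Finset.sum_congr rfl fun ξ _ => ?_
  have h1 : ((Equiv.swap y y').arrowCongr (Equiv.refl Bool)) ξ = ξ ∘ Equiv.swap y y' := by
    ext z
    simp [Equiv.arrowCongr]
  rw [h1, hw y hyB y' hyB', Finset.prod_insert hyA, Finset.prod_insert hyA']
  congr 2
  · simp
  · refine Finset.prod_congr rfl fun z hz => ?_
    rw [Function.comp_apply, Equiv.swap_apply_of_ne_of_ne]
    · rintro rfl; exact hyA hz
    · rintro rfl; exact hyA' hz

lemma corr_insert_mul (hw : ∀ y ∈ B, ∀ y' ∈ B, ∀ ξ, w (ξ ∘ Equiv.swap y y') = w ξ) {m : ℝ}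
    (hm : ∀ ξ, w ξ ≠ 0 → ∑ y ∈ B, bval (ξ y) = m)
    {A : Finset α} {y₀ : α} (hAB : A ⊆ B) (hyB : y₀ ∈ B) (hyA : y₀ ∉ A) :
    ((B.card : ℝ) - A.card) * corr w (insert y₀ A) = (m - A.card) * corr w A := by
  have hsum : ∑ y ∈ B, corr w (insert y A) = m * corr w A := by
    unfold corr
    rw [Finset.sum_comm, Finset.mul_sum]
    refine Finset.sum_congr rfl fun ξ _ => ?_
    by_cases h0 : w ξ = 0
    · simp [h0]
    rw [← hm ξ h0, Finset.sum_mul]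
    refine Finset.sum_congr rfl fun y _ => ?_
    by_cases hy : y ∈ A
    · rw [Finset.insert_eq_of_mem hy, ← Finset.mul_prod_erase A _ hy]
      cases h : ξ y <;> simp [bval]
    · rw [Finset.prod_insert hy]
      ring
  rw [← Finset.sum_sdiff hAB,
    Finset.sum_congr rfl (g := fun _ => corr w (insert y₀ A)) fun y hy =>
      corr_insert_eq hw (Finset.mem_sdiff.mp hy).1 (Finset.mem_sdiff.mp hy).2 hyB hyA,
    Finset.sum_congr (s₁ := A) rfl (g := fun _ => corr w A) fun y hy => by
      rw [Finset.insert_eq_of_mem hy],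
    Finset.sum_const, Finset.sum_const, Finset.card_sdiff_of_subset hAB, nsmul_eq_mul,
    nsmul_eq_mul, Nat.cast_sub (Finset.card_le_card hAB)] at hsum
  linarith

/-- Second order approximation of the `k`-point hypergeometric correlation at density `ρ`
in volume `M`. -/
def corrApprox (k : ℕ) (ρ M : ℝ) : ℝ :=
  ρ ^ k - chi ρ / (2 * M) * (k * ((k - 1 : ℕ) * ρ ^ (k - 1 - 1)))

/-- Constant controlling the error of `corrApprox`. -/
def corrConst : ℕ → ℝ
  | 0 => 0
  | k + 1 => (1 + k) * corrConst k + k ^ 2 * (k + 1) ^ 2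

lemma corrConst_nonneg (k : ℕ) : 0 ≤ corrConst k := by
  induction k with
  | zero => simp [corrConst]
  | succ k ih => simp only [corrConst]; positivity

lemma corrApprox_succ (k : ℕ) (ρ M : ℝ) :
    corrApprox (k + 1) ρ M = ρ ^ (k + 1) - (1 - ρ) / (2 * M) * ((k + 1) * (k * ρ ^ k)) := by
  rcases k with _ | k
  · simp [corrApprox]
  · simp only [corrApprox, chi, Nat.add_sub_cancel]
    push_cast
    ring

lemma corrApprox_step {k : ℕ} {ρ M g : ℝ} (hρ0 : 0 ≤ ρ) (hρ1 : ρ ≤ 1) (hM : (k:ℝ) + 1 ≤ M)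
    (hg : |g - corrApprox k ρ M| ≤ corrConst k / M ^ 2) :
    |(ρ * M - k) / (M - k) * g - corrApprox (k + 1) ρ M| ≤ corrConst (k + 1) / M ^ 2 := by
  have hk0 : (0:ℝ) ≤ k := Nat.cast_nonneg k
  have hM0 : 0 < M := by linarith
  have hMk : 0 < M - k := by linarith
  rcases k with _ | k
  · have h0 : g = 1 := by
      have : |g - 1| ≤ 0 := by simpa [corrApprox, corrConst] using hg
      linarith [abs_nonpos_iff.mp this]
    rw [corrApprox_succ]
    simp [h0, corrConst, hM0.ne']
  set K : ℝ := ((k + 1 : ℕ) : ℝ) with hK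
  have hK1 : K = k + 1 := by simp [hK]
  have hk0' : (0:ℝ) ≤ k := Nat.cast_nonneg k
  have hinv : 1 / (M - K) ≤ (K + 1) / M := by
    rw [div_le_div_iff₀ hMk hM0]
    nlinarith
  have hr : |(ρ * M - K) / (M - K)| ≤ 1 + K := by
    rw [abs_div, abs_of_pos hMk, div_le_iff₀ hMk, abs_le]
    constructor <;> nlinarith
  have hp0 : 0 ≤ ρ ^ k := pow_nonneg hρ0 k
  have hp1 : ρ ^ k ≤ 1 := pow_le_one₀ hρ0 hρ1
  have hq0 : 0 ≤ ρ ^ (k + 1) := pow_nonneg hρ0 _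
  have hq1 : ρ ^ (k + 1) ≤ 1 := pow_le_one₀ hρ0 hρ1
  have hmain : (ρ * M - K) / (M - K) * corrApprox (k + 1) ρ M - corrApprox (k + 1 + 1) ρ M =
      K ^ 2 * (1 - ρ) / M * (1 / (M - K)) * (k * (1 - ρ) * ρ ^ k / 2 - ρ ^ (k + 1)) := by
    rw [corrApprox_succ, corrApprox_succ, ← hK, hK1]
    rw [hK1] at hMk
    have := hMk.ne'
    field_simp
    ring
  have hx : |k * (1 - ρ) * ρ ^ k / 2 - ρ ^ (k + 1)| ≤ K + 1 := by
    have h1 : 0 ≤ (1 - ρ) * ρ ^ k := mul_nonneg (by linarith) hp0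
    have h2 : (1 - ρ) * ρ ^ k ≤ 1 := mul_le_one₀ (by linarith) hp0 hp1
    have h3 : 0 ≤ k * ((1 - ρ) * ρ ^ k) := mul_nonneg hk0' h1
    have h4 : k * ((1 - ρ) * ρ ^ k) ≤ k * 1 := mul_le_mul_of_nonneg_left h2 hk0'
    rw [abs_le]
    constructor <;> nlinarith
  have hmain' : |(ρ * M - K) / (M - K) * corrApprox (k + 1) ρ M - corrApprox (k + 1 + 1) ρ M| ≤
      K ^ 2 * (K + 1) ^ 2 / M ^ 2 := by
    have h5 : 0 ≤ K ^ 2 * (1 - ρ) / M :=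
      div_nonneg (mul_nonneg (sq_nonneg _) (by linarith)) hM0.le
    have h6 : K ^ 2 * (1 - ρ) / M ≤ K ^ 2 / M := by
      gcongr
      nlinarith [sq_nonneg K]
    have h7 : 0 ≤ 1 / (M - K) := by positivity
    rw [hmain, abs_mul, abs_of_nonneg (mul_nonneg h5 h7)]
    calc _ ≤ (K ^ 2 / M * ((K + 1) / M)) * (K + 1) := by gcongr
      _ = _ := by field_simp
  calc |(ρ * M - K) / (M - K) * g - corrApprox (k + 1 + 1) ρ M|
      = |(ρ * M - K) / (M - K) * (g - corrApprox (k + 1) ρ M) +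
          ((ρ * M - K) / (M - K) * corrApprox (k + 1) ρ M
            - corrApprox (k + 1 + 1) ρ M)| := by ring_nf
    _ ≤ (1 + K) * (corrConst (k + 1) / M ^ 2) + K ^ 2 * (K + 1) ^ 2 / M ^ 2 := by
        refine (abs_add_le _ _).trans (add_le_add ?_ hmain')
        rw [abs_mul]
        gcongr
    _ = corrConst (k + 1 + 1) / M ^ 2 := by
        rw [corrConst.eq_def (k + 1 + 1)]
        simp only [← hK]
        ring

lemma abs_corr_sub_corrApprox_le
    (hw : ∀ y ∈ B, ∀ y' ∈ B, ∀ ξ, w (ξ ∘ Equiv.swap y y') = w ξ) {ρ : ℝ}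
    (hm : ∀ ξ, w ξ ≠ 0 → ∑ y ∈ B, bval (ξ y) = ρ * B.card)
    (hw0 : ∑ ξ, w ξ ≠ 0) (hρ0 : 0 ≤ ρ) (hρ1 : ρ ≤ 1) (A : Finset α) (hAB : A ⊆ B) :
    |corr w A / (∑ ξ, w ξ) - corrApprox A.card ρ B.card| ≤
      corrConst A.card / (B.card : ℝ) ^ 2 := by
  induction A using Finset.induction_on with
  | empty => simp [corr, corrApprox, corrConst, div_self hw0]
  | insert y A hy ih =>
    obtain ⟨hyB, hA⟩ := Finset.insert_subset_iff.mp hAB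
    have hcard : (A.card : ℝ) + 1 ≤ B.card := by
      have := Finset.card_le_card hAB
      rw [Finset.card_insert_of_notMem hy] at this
      exact_mod_cast this
    have hne : (B.card : ℝ) - A.card ≠ 0 := by linarith
    have hrec : corr w (insert y A) = (ρ * B.card - A.card) / (B.card - A.card) * corr w A := by
      rw [div_mul_eq_mul_div, eq_div_iff hne, mul_comm, corr_insert_mul hw hm hA hyB hy]
    rw [Finset.card_insert_of_notMem hy, hrec, mul_div_assoc]
    exact corrApprox_step hρ0 hρ1 hcard (ih hA)

end Exchangeable

/-! ### Blocks in the torus -/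

lemma castT_injOn_box {d N ℓ : ℕ} (hN : 2 * ℓ < N) :
    Set.InjOn (castT d N) (box d ℓ : Set (Fin d → ℤ)) := by
  intro z hz z' hz' hzz
  ext j
  have hj := Finset.mem_Icc.mp (Fintype.mem_piFinset.mp hz j)
  have hj' := Finset.mem_Icc.mp (Fintype.mem_piFinset.mp hz' j)
  have hdvd := (ZMod.intCast_eq_intCast_iff_dvd_sub _ _ _).mp (congrFun hzz j)
  have := Int.eq_zero_of_abs_lt_dvd hdvd (by rw [abs_lt]; constructor <;> omega)
  omega

lemma card_box (d ℓ : ℕ) : (box d ℓ).card = (2 * ℓ + 1) ^ d := by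
  rw [box, Fintype.card_piFinset_const, Int.card_Icc]
  congr 1
  omega

lemma zero_mem_box (d ℓ : ℕ) : (0 : Fin d → ℤ) ∈ box d ℓ := by
  simp [box]

lemma exists_subset_box {d : ℕ} (S : Finset (Fin d → ℤ)) : ∃ L, ∀ ℓ ≥ L, S ⊆ box d ℓ := by
  refine ⟨∑ z ∈ S, ∑ j, (z j).natAbs, fun ℓ hℓ z hz => ?_⟩
  refine Fintype.mem_piFinset.mpr fun j => Finset.mem_Icc.mpr ?_
  have h1 : (z j).natAbs ≤ ∑ j, (z j).natAbs :=
    Finset.single_le_sum (f := fun j => (z j).natAbs) (fun _ _ => Nat.zero_le _)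
      (Finset.mem_univ j)
  have h2 : ∑ j, (z j).natAbs ≤ ∑ z ∈ S, ∑ j, (z j).natAbs :=
    Finset.single_le_sum (f := fun z : Fin d → ℤ => ∑ j, (z j).natAbs)
      (fun _ _ => Nat.zero_le _) hz
  omega

section Block

variable {d N ℓ : ℕ}

lemma shift_injOn_box (hN : 2 * ℓ < N) (x : Tor d N) :
    Set.InjOn (fun w => x + castT d N w) (box d ℓ : Set (Fin d → ℤ)) :=
  fun _ hz _ hz' h => castT_injOn_box hN hz hz' (add_left_cancel h)

lemma card_ball (hN : 2 * ℓ < N) (x : Tor d N) : (ball d N ℓ x).card = (2 * ℓ + 1) ^ d := by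
  rw [ball, Finset.card_image_of_injOn (shift_injOn_box hN x), card_box]

lemma sum_ball_eq (hN : 2 * ℓ < N) (x : Tor d N) (ξ : Conf d N) :
    ∑ y ∈ ball d N ℓ x, bval (ξ y) = avg d N ℓ x ξ * (ball d N ℓ x).card := by
  rw [card_ball hN, ball, Finset.sum_image (shift_injOn_box hN x), avg]
  have : (2 * (ℓ:ℝ) + 1) ^ d ≠ 0 := by positivity
  push_cast
  field_simp

lemma avg_mem_Icc (hN : 2 * ℓ < N) (x : Tor d N) (ξ : Conf d N) :
    avg d N ℓ x ξ ∈ Set.Icc (0:ℝ) 1 := by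
  have hpos : (0:ℝ) < (ball d N ℓ x).card := by
    rw [card_ball hN]
    positivity
  have hb : ∀ b, 0 ≤ bval b ∧ bval b ≤ 1 := by intro b; cases b <;> simp [bval]
  have h := sum_ball_eq hN x ξ
  have h0 : 0 ≤ ∑ y ∈ ball d N ℓ x, bval (ξ y) := Finset.sum_nonneg fun y _ => (hb _).1
  have h1 : ∑ y ∈ ball d N ℓ x, bval (ξ y) ≤ (ball d N ℓ x).card := by
    simpa using Finset.sum_le_sum (s := ball d N ℓ x) (g := fun _ => (1:ℝ))
      fun y _ => (hb (ξ y)).2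
  constructor <;> nlinarith

lemma avg_comp_swap (hN : 2 * ℓ < N) (x : Tor d N) {y y' : Tor d N}
    (hy : y ∈ ball d N ℓ x) (hy' : y' ∈ ball d N ℓ x) (ξ : Conf d N) :
    avg d N ℓ x (ξ ∘ Equiv.swap y y') = avg d N ℓ x ξ := by
  have hpos : ((ball d N ℓ x).card : ℝ) ≠ 0 := by
    rw [card_ball hN]
    positivity
  refine mul_right_cancel₀ hpos ?_
  rw [← sum_ball_eq hN, ← sum_ball_eq hN]
  refine Equiv.Perm.sum_comp (Equiv.swap y y') (ball d N ℓ x) (fun z => bval (ξ z)) ?_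
  intro z hz
  by_contra hzB
  refine hz (Equiv.swap_apply_of_ne_of_ne ?_ ?_)
  · rintro rfl; exact hzB hy
  · rintro rfl; exact hzB hy'

open scoped Classical in
/-- Bernoulli(1/2) weight restricted to the configurations with the block average of `η`. -/
def blockWeight (d N : ℕ) [NeZero N] (ℓ : ℕ) (x : Tor d N) (η ξ : Conf d N) : ℝ :=
  if avg d N ℓ x ξ = avg d N ℓ x η then prodM d N (fun _ => (1:ℝ)/2) ξ else 0

variable [NeZero N]

lemma condExpUnif_eq (x : Tor d N) (F : Conf d N → ℝ) (η : Conf d N) :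
    condExpUnif d N ℓ x F η =
      (∑ ξ, F ξ * blockWeight d N ℓ x η ξ) / ∑ ξ, blockWeight d N ℓ x η ξ := by
  simp only [condExpUnif, blockWeight, mul_ite, mul_zero]

lemma prodM_half_pos (ξ : Conf d N) : 0 < prodM d N (fun _ => (1:ℝ)/2) ξ := by
  refine Finset.prod_pos fun y _ => ?_
  cases h : ξ y <;> norm_num [bern]

lemma sum_blockWeight_pos (x : Tor d N) (η : Conf d N) :
    0 < ∑ ξ, blockWeight d N ℓ x η ξ := by
  refine Finset.sum_pos' (fun ξ _ => ?_) ⟨η, Finset.mem_univ _, ?_⟩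
  · unfold blockWeight
    split_ifs
    exacts [(prodM_half_pos ξ).le, le_rfl]
  · simpa [blockWeight] using prodM_half_pos η

lemma blockWeight_comp_swap (hN : 2 * ℓ < N) (x : Tor d N) (η : Conf d N) :
    ∀ y ∈ ball d N ℓ x, ∀ y' ∈ ball d N ℓ x, ∀ ξ,
      blockWeight d N ℓ x η (ξ ∘ Equiv.swap y y') = blockWeight d N ℓ x η ξ := by
  intro y hy y' hy' ξ
  have h : prodM d N (fun _ => (1:ℝ)/2) (ξ ∘ Equiv.swap y y') =
      prodM d N (fun _ => (1:ℝ)/2) ξ :=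
    Equiv.prod_comp (Equiv.swap y y') fun z => bern (1/2) (ξ z)
  simp only [blockWeight, avg_comp_swap hN x hy hy', h]

lemma sum_ball_of_blockWeight_ne_zero (hN : 2 * ℓ < N) (x : Tor d N) (η ξ : Conf d N)
    (h : blockWeight d N ℓ x η ξ ≠ 0) :
    ∑ y ∈ ball d N ℓ x, bval (ξ y) = avg d N ℓ x η * (ball d N ℓ x).card := by
  rw [sum_ball_eq hN]
  by_contra hne
  exact h (if_neg fun h' => hne (by rw [h']))

lemma condExpUnif_bval (hN : 2 * ℓ < N) (x : Tor d N) (η : Conf d N) :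
    condExpUnif d N ℓ x (fun ξ => bval (ξ x)) η = avg d N ℓ x η := by
  have hx : x ∈ ball d N ℓ x := by
    refine Finset.mem_image.mpr ⟨0, zero_mem_box d ℓ, ?_⟩
    ext j
    simp [castT]
  have h := corr_insert_mul (blockWeight_comp_swap hN x η)
    (sum_ball_of_blockWeight_ne_zero hN x η) (Finset.empty_subset _) hx (Finset.notMem_empty x)
  have hpos : ((ball d N ℓ x).card : ℝ) ≠ 0 := by
    rw [card_ball hN]
    positivity
  rw [condExpUnif_eq, div_eq_iff (sum_blockWeight_pos x η).ne']
  refine mul_left_cancel₀ hpos ?_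
  simp only [corr, insert_empty_eq, Finset.prod_singleton, Finset.card_empty, Nat.cast_zero,
    sub_zero, Finset.prod_empty, one_mul] at h
  rw [h]
  ring

lemma condExpUnif_centered (x : Tor d N) (F G : Conf d N → ℝ) (a b v : ℝ) (η : Conf d N) :
    condExpUnif d N ℓ x (fun ξ => F ξ - a - b * (G ξ - v)) η =
      condExpUnif d N ℓ x F η - a - b * (condExpUnif d N ℓ x G η - v) := by
  have hne := (sum_blockWeight_pos (ℓ := ℓ) x η).ne'
  simp only [condExpUnif_eq]
  field_simp
  simp only [Finset.mul_sum, ← Finset.sum_sub_distrib]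
  exact Finset.sum_congr rfl fun ξ _ => by ring

lemma condExpUnif_sum_obs {S : Finset (Fin d → ℤ)} (hN : 2 * ℓ < N) (hS : S ⊆ box d ℓ)
    (c : Finset {z // z ∈ S} → ℝ) (x : Tor d N) (η : Conf d N) :
    |condExpUnif d N ℓ x (fun ξ => ∑ A, c A * ∏ z ∈ A, bval (obs ξ x z)) η
        - ∑ A, c A * corrApprox A.card (avg d N ℓ x η) (ball d N ℓ x).card| ≤
      (∑ A, |c A| * corrConst A.card) / ((ball d N ℓ x).card : ℝ) ^ 2 := by
  set f : {z // z ∈ S} → Tor d N := fun z => x + castT d N z with hf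
  have hinj : Function.Injective f := fun z z' h =>
    Subtype.ext (shift_injOn_box hN x (hS z.2) (hS z'.2) h)
  have hCE : condExpUnif d N ℓ x (fun ξ => ∑ A, c A * ∏ z ∈ A, bval (obs ξ x z)) η =
      ∑ A : Finset {z // z ∈ S}, c A * (corr (blockWeight d N ℓ x η) (A.image f) /
        ∑ ξ, blockWeight d N ℓ x η ξ) := by
    rw [condExpUnif_eq]
    simp only [corr, ← mul_div_assoc, ← Finset.sum_div, Finset.mul_sum, Finset.sum_mul]
    rw [Finset.sum_comm]
    congr 1
    refine Finset.sum_congr rfl fun A _ => Finset.sum_congr rfl fun ξ _ => ?_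
    rw [Finset.prod_image hinj.injOn, mul_assoc]
    rfl
  rw [hCE, ← Finset.sum_sub_distrib, Finset.sum_div]
  refine (Finset.abs_sum_le_sum_abs _ _).trans (Finset.sum_le_sum fun A _ => ?_)
  rw [← mul_sub, abs_mul, mul_div_assoc]
  refine mul_le_mul_of_nonneg_left ?_ (abs_nonneg _)
  have hρ := avg_mem_Icc hN x η
  have h := abs_corr_sub_corrApprox_le (blockWeight_comp_swap hN x η)
    (sum_ball_of_blockWeight_ne_zero hN x η) (sum_blockWeight_pos x η).ne' hρ.1 hρ.2
    (A.image f) (Finset.image_subset_iff.mpr fun z _ =>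
      Finset.mem_image_of_mem (fun w => x + castT d N w) (hS z.2))
  rwa [Finset.card_image_of_injective _ hinj] at h

end Block

/-- Equivalence of ensembles, Lemma `l:GJ13:P31`.  For a local function `h`,
`\tilde h(ρ) = E^{ν_ρ}[h]`, `f^{(u)}(η) = h(η) - \tilde h(u) - \tilde h'(u)(η_0 - u)`, and a
block scale `ℓ(N) → ∞` with `ℓ(N)/N → 0`, the conditional expectation of `τ_x f^{(u)}` given
the block average `η_x^ℓ` under the Bernoulli(1/2) measure is approximated by
`\tilde f^{(u)}(η_x^ℓ) - χ(η_x^ℓ)/(2 ℓ_*^d) (\tilde f^{(u)})''(η_x^ℓ)` up to `C/ℓ^{2d}`,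
uniformly in `x`, `u ∈ [0,1]` and `η`.  (Here `N = n+1`.) -/
theorem stmt_16 (d : ℕ) (hd : 1 ≤ d)
    (Sh : Finset (Fin d → ℤ)) (h : ((Fin d → ℤ) → Bool) → ℝ) (hloc : IsLocal Sh h)
    (ℓ : ℕ → ℕ)
    (hℓ_top : Filter.Tendsto ℓ Filter.atTop Filter.atTop)
    (hℓ_N : Filter.Tendsto (fun n => (ℓ n : ℝ) / ((n:ℝ)+1)) Filter.atTop (nhds 0)) :
    ∃ C > 0, ∃ n₀ : ℕ, ∀ n ≥ n₀, ∀ x : Tor d (n+1), ∀ u ∈ Set.Icc (0:ℝ) 1,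
      ∀ η : Conf d (n+1),
      |condExpUnif d (n+1) (ℓ n) x
          (fun ξ => h (obs ξ x) - bExp u Sh h
            - deriv (fun β => bExp β Sh h) u * (bval (ξ x) - u)) η
        - (fun β => bExp β Sh h - bExp u Sh h
            - deriv (fun β' => bExp β' Sh h) u * (β - u)) (avg d (n+1) (ℓ n) x η)
        + chi (avg d (n+1) (ℓ n) x η) / (2 * (2*((ℓ n : ℝ))+1)^d)
            * deriv (deriv (fun β => bExp β Sh h - bExp u Sh h
                - deriv (fun β' => bExp β' Sh h) u * (β - u))) (avg d (n+1) (ℓ n) x η)|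
      ≤ C / (ℓ n : ℝ)^(2*d) := by
  obtain ⟨c, hbExp, hh⟩ := hloc.exists_coeff
  obtain ⟨L, hL⟩ := exists_subset_box Sh
  have hN_ev : ∀ᶠ n in Filter.atTop, 2 * ℓ n < n + 1 := by
    filter_upwards [hℓ_N.eventually (gt_mem_nhds (show (0:ℝ) < 1/2 by norm_num))] with n hn
    rw [div_lt_iff₀ (by positivity)] at hn
    have : (2 * ℓ n : ℝ) < n + 1 := by linarith
    exact_mod_cast this
  obtain ⟨n₀, hn₀⟩ := Filter.eventually_atTop.mp
    ((hN_ev.and (hℓ_top.eventually_ge_atTop L)).and (hℓ_top.eventually_ge_atTop 1))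
  have hK : 0 ≤ ∑ A : Finset {z // z ∈ Sh}, |c A| * corrConst A.card :=
    Finset.sum_nonneg fun A _ => mul_nonneg (abs_nonneg _) (corrConst_nonneg _)
  refine ⟨(∑ A : Finset {z // z ∈ Sh}, |c A| * corrConst A.card) + 1, by linarith, n₀, ?_⟩
  intro n hn x u _ η
  obtain ⟨⟨hN, hℓL⟩, hℓ1⟩ := hn₀ n hn
  have hℓpos : (0:ℝ) < ℓ n := by exact_mod_cast hℓ1
  have hest := condExpUnif_sum_obs hN (hL _ hℓL) c x η
  have hcard : ((ball d (n+1) (ℓ n) x).card : ℝ) = (2 * (ℓ n : ℝ) + 1) ^ d := by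
    rw [card_ball hN]
    push_cast
    rfl
  rw [hcard] at hest
  rw [condExpUnif_centered x (fun ξ => h (obs ξ x)) (fun ξ => bval (ξ x)),
    condExpUnif_bval hN]
  simp only [hbExp, hh]
  rw [deriv_deriv_sum_pow]
  refine le_trans (le_of_eq ?_) (hest.trans ?_)
  · congr 1
    simp only [corrApprox, mul_sub, Finset.sum_sub_distrib]
    rw [Finset.mul_sum]
    simp only [mul_left_comm (c _) (chi _ / _)]
    ring
  · have hle : (ℓ n : ℝ) ^ (2 * d) ≤ ((2 * (ℓ n : ℝ) + 1) ^ d) ^ 2 := by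
      rw [← pow_mul, mul_comm d 2]
      gcongr
      linarith
    gcongr
    linarith

end
end GK
end

section
/- Let 0 < u_- < u_+ < 1 and let P : [u_-, u_+] → ℝ be twice continuously differentiable. Define χ(u) := u(1−u). Then there exists a constant C > 0 such that for all a, b ∈ [u_-, u_+]: | (P(a) − P(b))/χ(a) − P'(b)·b·( 1/χ(b) − 1/χ(a) ) + P'(a)·( b/χ(b) − a/χ(a) ) | ≤ C (b − a)². (This is the second-order cancellation showing that the sum J_{1,1} + J_{2,1} + J_{3,1} in the relative entropy computation is of order K^{3/σ} N^{d−1}.) -/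
namespace GK

open Finset

noncomputable section

/-- First-order Taylor bound for a function whose derivative is Lipschitz on a convex set. -/
theorem abs_taylor_one_le {s : Set ℝ} (hs : Convex ℝ s) {f f' : ℝ → ℝ} {M : ℝ} (hM : 0 ≤ M)
    (hf : ∀ x ∈ s, HasDerivWithinAt f (f' x) s x)
    (hL : ∀ x ∈ s, ∀ y ∈ s, |f' x - f' y| ≤ M * |x - y|)
    {a b : ℝ} (ha : a ∈ s) (hb : b ∈ s) :
    |f a - f b - f' b * (a - b)| ≤ M * (b - a) ^ 2 := by
  have hsub : Set.uIcc b a ⊆ s := hs.ordConnected.uIcc_subset hb ha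
  have key := (convex_uIcc b a).norm_image_sub_le_of_norm_hasDerivWithin_le
    (f := fun x => f x - f' b * x) (f' := fun x => f' x - f' b) (C := M * |a - b|)
    (fun x hx => by
      simpa using ((hf x (hsub hx)).mono hsub).fun_sub
        ((hasDerivWithinAt_id x (Set.uIcc b a)).const_mul (f' b)))
    (fun x hx => (hL x (hsub hx) b hb).trans
      (mul_le_mul_of_nonneg_left (Set.abs_sub_left_of_mem_uIcc hx) hM))
    Set.left_mem_uIcc Set.right_mem_uIcc
  simp only [Real.norm_eq_abs] at key
  calc |f a - f b - f' b * (a - b)| = |f a - f' b * a - (f b - f' b * b)| := by ring_nf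
    _ ≤ M * |a - b| * |a - b| := key
    _ = M * (b - a) ^ 2 := by rw [mul_assoc, abs_mul_abs_self]; ring

/-- The derivative of a `C²` function on a compact interval is Lipschitz. -/
theorem exists_abs_derivWithin_sub_le {u v : ℝ} (huv : u < v) {f : ℝ → ℝ}
    (hf : ContDiffOn ℝ 2 f (Set.Icc u v)) :
    ∃ M, 0 ≤ M ∧ ∀ x ∈ Set.Icc u v, ∀ y ∈ Set.Icc u v,
      |derivWithin f (Set.Icc u v) x - derivWithin f (Set.Icc u v) y| ≤ M * |x - y| := by
  have hd : ContDiffOn ℝ 1 (derivWithin f (Set.Icc u v)) (Set.Icc u v) :=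
    hf.derivWithin (uniqueDiffOn_Icc huv) (by norm_num)
  obtain ⟨K, hK⟩ := hd.exists_lipschitzOnWith one_ne_zero (convex_Icc u v) isCompact_Icc
  exact ⟨K, K.2, fun x hx y hy => by simpa [Real.dist_eq] using hK.dist_le_mul x hx y hy⟩

/-- second-order cancellation in the coefficient of the sum
`J_{1,1} + J_{2,1} + J_{3,1}` of the relative entropy computation: for `P` twice continuously
differentiable on `[u_-, u_+] ⊂ (0,1)` and `χ(u) = u(1-u)`, the displayed combination is
`O((b-a)²)` uniformly in `a, b ∈ [u_-, u_+]`. -/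
theorem stmt_19 (um up : ℝ) (h0 : 0 < um) (hmp : um < up) (h1 : up < 1)
    (P : ℝ → ℝ) (hP : ContDiffOn ℝ 2 P (Set.Icc um up)) :
    ∃ C > 0, ∀ a ∈ Set.Icc um up, ∀ b ∈ Set.Icc um up,
      |(P a - P b) / chi a
        - derivWithin P (Set.Icc um up) b * b * (1 / chi b - 1 / chi a)
        + derivWithin P (Set.Icc um up) a * (b / chi b - a / chi a)|
      ≤ C * (b - a)^2 := by
  obtain ⟨M, hM, hL⟩ := exists_abs_derivWithin_sub_le hmp hP
  have hq : 0 < 1 - up := by linarith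
  refine ⟨2 * M / (um * (1 - up) ^ 2) + 1, by positivity, fun a ha b hb => ?_⟩
  have hR := abs_taylor_one_le (convex_Icc um up) hM
    (fun x hx => (hP.differentiableOn two_ne_zero x hx).hasDerivWithinAt) hL ha hb
  have hD := hL a ha b hb
  generalize derivWithin P (Set.Icc um up) a = p at *
  generalize derivWithin P (Set.Icc um up) b = q at *
  have ha0 : 0 < a := h0.trans_le ha.1
  have hb0 : 0 < b := h0.trans_le hb.1
  have ha1 : 1 - up ≤ 1 - a := by linarith [ha.2]
  have hb1 : 1 - up ≤ 1 - b := by linarith [hb.2]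
  have ha2 : 0 < 1 - a := hq.trans_le ha1
  have hb2 : 0 < 1 - b := hq.trans_le hb1
  have hE : (P a - P b) / chi a - q * b * (1 / chi b - 1 / chi a) + p * (b / chi b - a / chi a)
      = ((b - a) * a * (p - q) + (P a - P b - q * (a - b)) * (1 - b))
        / (a * ((1 - a) * (1 - b))) := by
    unfold chi
    field_simp
    ring
  have hden : um * (1 - up) ^ 2 ≤ a * ((1 - a) * (1 - b)) := by
    rw [sq]
    gcongr
    exact ha.1
  have hnum : |(b - a) * a * (p - q) + (P a - P b - q * (a - b)) * (1 - b)|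
      ≤ 2 * M * (b - a) ^ 2 := by
    calc _ ≤ |b - a| * a * |p - q| + |P a - P b - q * (a - b)| * (1 - b) := by
          refine (abs_add_le _ _).trans_eq ?_
          rw [abs_mul, abs_mul, abs_mul, abs_of_pos ha0, abs_of_pos hb2]
      _ ≤ |b - a| * 1 * (M * |a - b|) + M * (b - a) ^ 2 * 1 := by
          gcongr <;> linarith
      _ = 2 * M * (b - a) ^ 2 := by
          rw [abs_sub_comm a b, ← sq_abs (b - a)]
          ring
  rw [hE, abs_div, abs_of_pos (by positivity : 0 < a * ((1 - a) * (1 - b)))]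
  calc _ ≤ 2 * M * (b - a) ^ 2 / (um * (1 - up) ^ 2) := by gcongr
    _ = 2 * M / (um * (1 - up) ^ 2) * (b - a) ^ 2 := by ring
    _ ≤ _ := by
      gcongr
      linarith

end
end GK
end
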